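/- Let 𝒮 be the class of functions on ℝ^m, m ≥ 1, of the form x ↦ φ(⟨θ,x⟩) with φ monotone on ℝ and θ in the unit sphere of ℝ^m. If f̄ = φ̄(⟨θ̄,·⟩) ∈ 𝒮 has a link function φ̄ that is K-piecewise constant on ℝ, then f̄ is extremal in 𝒮 with degree not larger than (m+1)·K. -/

import Mathlib

open scoped RealInnerProductSpace

/-- VC-dimension of `𝒜` is at most `D`. -/
def VCDimLE {Y : Type*} (𝒜 : Set (Set Y)) (D : ℕ) : Prop :=
  ∀ B : Finset Y, D < B.card → ∃ C : Set Y, C ⊆ ↑B ∧ ∀ A ∈ 𝒜, (↑B ∩ A : Set Y) ≠ C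

/-- `gbar` is extremal in `𝒢` with degree at most `D`. -/
def ExtremalDegLE {Y : Type*} (𝒢 : Set (Y → ℝ)) (gbar : Y → ℝ) (D : ℕ) : Prop :=
  VCDimLE {S | ∃ g ∈ 𝒢, S = {y | gbar y < g y}} D ∧
  VCDimLE {S | ∃ g ∈ 𝒢, S = {y | g y < gbar y}} D

/-- `P` is a partition of `ℝ` into nontrivial intervals. -/
def IsIntervalPartitionR (P : Finset (Set ℝ)) : Prop :=
  (∀ J ∈ P, J.OrdConnected ∧ J.Nontrivial) ∧ ∀ y : ℝ, ∃! J, J ∈ P ∧ y ∈ J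

/-- `φ` is `K`-piecewise constant on `ℝ`. -/
def PiecewiseConstR (K : ℕ) (φ : ℝ → ℝ) : Prop :=
  ∃ P : Finset (Set ℝ), P.card ≤ K ∧ IsIntervalPartitionR P ∧
    ∀ J ∈ P, ∃ c : ℝ, ∀ y ∈ J, φ y = c

/-- The single index class `𝒮` of functions `x ↦ φ(⟨θ,x⟩)` with `φ` monotone on `ℝ`
and `θ` in the unit sphere of `ℝ^m`. -/
def SingleIndexClass (m : ℕ) : Set (EuclideanSpace ℝ (Fin m) → ℝ) :=
  {f | ∃ (φ : ℝ → ℝ) (θ : EuclideanSpace ℝ (Fin m)), (Monotone φ ∨ Antitone φ) ∧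
    ‖θ‖ = 1 ∧ f = fun x => φ ⟪θ, x⟫}

/-- A finite set of more than `finrank ℝ E + 1` points contains a subset which is not cut out by
any convex set with convex complement. -/
lemma exists_subset_inter_ne_of_finrank_add_one_lt_card {E : Type*} [AddCommGroup E] [Module ℝ E]
    [FiniteDimensional ℝ E] (B : Finset E) (hB : Module.finrank ℝ E + 1 < B.card) :
    ∃ C : Set E, C ⊆ ↑B ∧ ∀ H : Set E, Convex ℝ H → Convex ℝ Hᶜ → (↑B ∩ H : Set E) ≠ C := by
  have hdep : ¬ AffineIndependent ℝ ((↑) : B → E) := by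
    intro h
    have h1 := h.card_le_finrank_succ
    have h2 := (vectorSpan ℝ (Set.range ((↑) : B → E))).finrank_le
    rw [Fintype.card_coe] at h1
    omega
  obtain ⟨I, z, hzI, hzI'⟩ := Convex.radon_partition hdep
  refine ⟨(↑) '' I, by rintro _ ⟨x, -, rfl⟩; exact x.2, fun H hH hH' hBH => ?_⟩
  have hz : z ∈ H := by
    refine convexHull_min ?_ hH hzI
    rw [← hBH]
    exact Set.inter_subset_right
  refine convexHull_min ?_ hH' hzI' hz
  rintro _ ⟨x, hx, rfl⟩ hxH
  have hxI : (x : E) ∈ (↑) '' I := hBH ▸ ⟨x.2, hxH⟩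
  obtain ⟨y, hy, hyx⟩ := hxI
  exact hx (Subtype.ext hyx ▸ hy)

/-- If the space is covered by finitely many pieces, and each member of `𝒜` agrees on each piece
with a convex set with convex complement, then the VC-dimension of `𝒜` is at most
`finrank ℝ E + 1` times the number of pieces. -/
lemma vcDimLE_of_forall_piece_convex {E ι : Type*} [AddCommGroup E] [Module ℝ E]
    [FiniteDimensional ℝ E] (P : Finset ι) (Q : ι → Set E) (hcover : ∀ x, ∃ i ∈ P, x ∈ Q i)
    (𝒜 : Set (Set E))
    (h : ∀ A ∈ 𝒜, ∀ i ∈ P, ∃ H : Set E, Convex ℝ H ∧ Convex ℝ Hᶜ ∧ ∀ x ∈ Q i, x ∈ A ↔ x ∈ H)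
    {D : ℕ} (hD : (Module.finrank ℝ E + 1) * P.card ≤ D) : VCDimLE 𝒜 D := by
  classical
  intro B hB
  choose f hfP hfQ using hcover
  obtain ⟨i, hi, hcard⟩ := Finset.exists_lt_card_fiber_of_mul_lt_card_of_maps_to
    (s := B) (f := f) (fun x _ => hfP x)
    (show P.card * (Module.finrank ℝ E + 1) < B.card by rw [mul_comm]; omega)
  obtain ⟨C, hCB, hC⟩ := exists_subset_inter_ne_of_finrank_add_one_lt_card _ hcard
  refine ⟨C, fun x hx => (Finset.mem_filter.1 (hCB hx)).1, fun A hA hBA => ?_⟩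
  obtain ⟨H, hH, hH', hAH⟩ := h A hA i hi
  refine hC H hH hH' (Set.ext fun x => ?_)
  have hQ : f x = i → x ∈ Q i := fun hx => hx ▸ hfQ x
  rw [← hBA]
  constructor
  · rintro ⟨hx, hxH⟩
    obtain ⟨hxB, hxi⟩ := Finset.mem_filter.1 hx
    exact ⟨hxB, (hAH x (hQ hxi)).2 hxH⟩
  · intro hx
    have hxf := hCB (hBA ▸ hx)
    exact ⟨hxf, (hAH x (hQ (Finset.mem_filter.1 hxf).2)).1 hx.2⟩

/-- Strict superlevel sets of a single index function are convex with convex complement, and so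
are strict sublevel sets. -/
lemma SingleIndexClass.convex_level_sets {m : ℕ} {g : EuclideanSpace ℝ (Fin m) → ℝ}
    (hg : g ∈ SingleIndexClass m) (c : ℝ) :
    (Convex ℝ {x | c < g x} ∧ Convex ℝ {x | c < g x}ᶜ) ∧
      Convex ℝ {x | g x < c} ∧ Convex ℝ {x | g x < c}ᶜ := by
  obtain ⟨φ, θ, hφ, -, rfl⟩ := hg
  have key : ∀ s : Set ℝ, s.OrdConnected → Convex ℝ {x | φ ⟪θ, x⟫ ∈ s} := fun s hs => by
    have : (φ ⁻¹' s).OrdConnected :=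
      hφ.elim (fun h => hs.preimage_mono h) (fun h => hs.preimage_anti h)
    exact this.convex.linear_preimage (innerₗ _ θ)
  refine ⟨⟨key _ Set.ordConnected_Ioi, ?_⟩, key _ Set.ordConnected_Iio, ?_⟩
  · simpa [Set.compl_ofPred] using key _ (Set.ordConnected_Iic (a := c))
  · simpa [Set.compl_ofPred] using key _ (Set.ordConnected_Ici (a := c))

/-- Proposition 7: if `fbar = φbar(⟨θbar,·⟩) ∈ 𝒮` has a link
function `φbar` which is `K`-piecewise constant on `ℝ`, then `fbar` is extremal in `𝒮`
with degree not larger than `(m+1)·K`. -/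
theorem stmt14 (m : ℕ) (hm : 1 ≤ m) (K : ℕ) (hK : 1 ≤ K)
    (φbar : ℝ → ℝ) (θbar : EuclideanSpace ℝ (Fin m))
    (hφmono : Monotone φbar ∨ Antitone φbar) (hθ : ‖θbar‖ = 1)
    (hφ : PiecewiseConstR K φbar) :
    ExtremalDegLE (SingleIndexClass m) (fun x => φbar ⟪θbar, x⟫) ((m + 1) * K) := by
  obtain ⟨P, hPK, ⟨-, hP⟩, hconst⟩ := hφ
  have hcover : ∀ x : EuclideanSpace ℝ (Fin m), ∃ J ∈ P, x ∈ {x | ⟪θbar, x⟫ ∈ J} :=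
    fun x => (hP ⟪θbar, x⟫).exists
  have hD : (Module.finrank ℝ (EuclideanSpace ℝ (Fin m)) + 1) * P.card ≤ (m + 1) * K := by
    rw [finrank_euclideanSpace_fin]
    exact Nat.mul_le_mul_left _ hPK
  constructor
  · refine vcDimLE_of_forall_piece_convex P _ hcover _ ?_ hD
    rintro _ ⟨g, hg, rfl⟩ J hJ
    obtain ⟨c, hc⟩ := hconst J hJ
    obtain ⟨⟨h, h'⟩, -⟩ := SingleIndexClass.convex_level_sets hg c
    refine ⟨_, h, h', fun x hx => ?_⟩
    simp [hc _ hx]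
  · refine vcDimLE_of_forall_piece_convex P _ hcover _ ?_ hD
    rintro _ ⟨g, hg, rfl⟩ J hJ
    obtain ⟨c, hc⟩ := hconst J hJ
    obtain ⟨-, h, h'⟩ := SingleIndexClass.convex_level_sets hg c
    refine ⟨_, h, h', fun x hx => ?_⟩
    simp [hc _ hx]
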